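/- There exist universal constants C, C' > 0 such that for every n ≥ 1 and every ε, δ ∈ (0,1), setting k = ⌈C·(n^{2/3}·(log(1/δ))^{1/3}/ε^{4/3} + (n^{1/2}·(log(1/δ))^{1/2} + log(1/δ))/ε²)⌉, there exists a randomized tester A using k i.i.d. samples from each of two unknown distributions p, q on [n] such that: for all PMFs p, q on Fin n, if p = q then A outputs YES with probability at least 1 − δ, and if d_TV(p,q) ≥ ε then A outputs YES with probability at most δ. -/

import Mathlib

open scoped BigOperators

/-- `p` is a probability mass function on the finite type `α`. -/
def IsPMF {α : Type*} [Fintype α] (p : α → ℝ) : Prop :=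
  (∀ a, 0 ≤ p a) ∧ ∑ a, p a = 1

/-- Total variation distance between two distributions on `Fin n`. -/
noncomputable def tvDist {n : ℕ} (p q : Fin n → ℝ) : ℝ :=
  (1 / 2) * ∑ i, |p i - q i|

/-- Probability that the randomized tester `A` outputs YES, when it is given `k` i.i.d.
samples from `p` and `k` i.i.d. samples from `q`. -/
noncomputable def acceptProb {n k : ℕ} (p q : Fin n → ℝ)
    (A : (Fin k → Fin n) → (Fin k → Fin n) → ℝ) : ℝ :=
  ∑ x : Fin k → Fin n, ∑ y : Fin k → Fin n,
    (∏ i, p (x i)) * (∏ i, q (y i)) * A x y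

/-- Expectation of `f` over `k` i.i.d. samples from `P`. -/
noncomputable def Ex {α : Type*} [Fintype α] (k : ℕ) (P : α → ℝ) (f : (Fin k → α) → ℝ) : ℝ :=
  ∑ x : Fin k → α, (∏ i, P (x i)) * f x

section expectation
variable {α : Type*} [Fintype α]

lemma Ex_zero (P : α → ℝ) (f : (Fin 0 → α) → ℝ) : Ex 0 P f = f Fin.elim0 := by
  unfold Ex
  rw [Fintype.sum_unique]
  simp only [Finset.univ_eq_empty, Finset.prod_empty, one_mul]
  congr 1

lemma Ex_succ (k : ℕ) (P : α → ℝ) (f : (Fin (k+1) → α) → ℝ) :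
    Ex (k+1) P f = ∑ a, P a * Ex k P (fun x => f (Fin.cons a x)) := by
  unfold Ex
  rw [← (Fin.consEquiv (fun _ : Fin (k+1) => α)).sum_comp, Fintype.sum_prod_type]
  refine Finset.sum_congr rfl fun a _ => ?_
  rw [Finset.mul_sum]
  refine Finset.sum_congr rfl fun x _ => ?_
  simp [Fin.consEquiv, Fin.prod_univ_succ, mul_assoc]

lemma Ex_append (m l : ℕ) (P : α → ℝ) (f : (Fin (m+l) → α) → ℝ) :
    Ex (m+l) P f = Ex m P (fun x => Ex l P (fun y => f (Fin.append x y))) := by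
  unfold Ex
  rw [← (Fin.appendEquiv m l (α := α)).sum_comp, Fintype.sum_prod_type]
  refine Finset.sum_congr rfl fun a _ => ?_
  rw [Finset.mul_sum]
  refine Finset.sum_congr rfl fun x _ => ?_
  simp [Fin.appendEquiv, Fin.prod_univ_add, mul_assoc]

lemma Ex_add (k : ℕ) (P : α → ℝ) (f g : (Fin k → α) → ℝ) :
    Ex k P (fun x => f x + g x) = Ex k P f + Ex k P g := by
  simp [Ex, mul_add, Finset.sum_add_distrib]

lemma Ex_sub (k : ℕ) (P : α → ℝ) (f g : (Fin k → α) → ℝ) :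
    Ex k P (fun x => f x - g x) = Ex k P f - Ex k P g := by
  simp [Ex, mul_sub, Finset.sum_sub_distrib]

lemma Ex_smul (k : ℕ) (P : α → ℝ) (c : ℝ) (f : (Fin k → α) → ℝ) :
    Ex k P (fun x => c * f x) = c * Ex k P f := by
  simp only [Ex, Finset.mul_sum]
  exact Finset.sum_congr rfl fun x _ => by ring

lemma Ex_smul_right (k : ℕ) (P : α → ℝ) (c : ℝ) (f : (Fin k → α) → ℝ) :
    Ex k P (fun x => f x * c) = Ex k P f * c := by
  simp only [Ex, Finset.sum_mul]
  exact Finset.sum_congr rfl fun x _ => by ring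

lemma Ex_sum {ι : Type*} (s : Finset ι) (k : ℕ) (P : α → ℝ) (f : ι → (Fin k → α) → ℝ) :
    Ex k P (fun x => ∑ i ∈ s, f i x) = ∑ i ∈ s, Ex k P (f i) := by
  simp only [Ex, Finset.mul_sum]
  rw [Finset.sum_comm]

lemma Ex_const (k : ℕ) (P : α → ℝ) (hP : IsPMF P) (c : ℝ) :
    Ex k P (fun _ => c) = c := by
  induction k with
  | zero => rw [Ex_zero]
  | succ k ih => rw [Ex_succ]; simp only [ih]; rw [← Finset.sum_mul, hP.2, one_mul]

lemma Ex_mono (k : ℕ) (P : α → ℝ) (hP : IsPMF P) (f g : (Fin k → α) → ℝ)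
    (h : ∀ x, f x ≤ g x) : Ex k P f ≤ Ex k P g :=
  Finset.sum_le_sum fun x _ =>
    mul_le_mul_of_nonneg_left (h x) (Finset.prod_nonneg fun _ _ => hP.1 _)

/-- One-variable sub-Gaussian bound. -/
lemma single_mgf (P : α → ℝ) (hP : IsPMF P) (g : α → ℝ) (c : ℝ) (hc : 0 ≤ c)
    (hg : ∀ a b, |g a - g b| ≤ c) :
    ∑ a, P a * Real.exp (g a - ∑ b, P b * g b) ≤ Real.exp (c^2/2) := by
  set μ := ∑ b, P b * g b with hμ
  have hsub : ∀ a, |g a - μ| ≤ c := by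
    intro a
    have : g a - μ = ∑ b, P b * (g a - g b) := by
      simp only [mul_sub, Finset.sum_sub_distrib, ← Finset.sum_mul, hP.2, one_mul, hμ]
    rw [this]
    calc _ ≤ ∑ b, |P b * (g a - g b)| := Finset.abs_sum_le_sum_abs _ _
      _ ≤ ∑ b, P b * c := Finset.sum_le_sum fun b _ => by
          rw [abs_mul, abs_of_nonneg (hP.1 b)]
          exact mul_le_mul_of_nonneg_left (hg a b) (hP.1 b)
      _ = c := by rw [← Finset.sum_mul, hP.2, one_mul]
  rcases hc.eq_or_lt with rfl | hc
  · have : ∀ a, g a - μ = 0 := fun a => abs_nonpos_iff.mp (hsub a)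
    simp [this, hP.2]
  have key : ∀ a, Real.exp (g a - μ) ≤
      Real.cosh c + (g a - μ) * (Real.sinh c / c) := by
    intro a
    set y := g a - μ
    have hy := abs_le.mp (hsub a)
    have h := convexOn_exp.2 (Set.mem_univ (-c)) (Set.mem_univ c)
      (show 0 ≤ (c - y)/(2*c) from div_nonneg (by linarith) (by linarith))
      (show 0 ≤ (c + y)/(2*c) from div_nonneg (by linarith) (by linarith))
      (by field_simp; ring)
    have e1 : ((c - y)/(2*c)) • (-c) + ((c+y)/(2*c)) • c = y := by
      simp only [smul_eq_mul]; field_simp; ring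
    rw [e1] at h
    refine h.trans (le_of_eq ?_)
    rw [Real.cosh_eq, Real.sinh_eq]
    simp only [smul_eq_mul]; field_simp; ring
  have hz : ∑ a, P a * (g a - μ) = 0 := by
    simp only [mul_sub, Finset.sum_sub_distrib, ← Finset.sum_mul, hP.2, one_mul, hμ, sub_self]
  calc _ ≤ ∑ a, P a * (Real.cosh c + (g a - μ) * (Real.sinh c / c)) :=
        Finset.sum_le_sum fun a _ => mul_le_mul_of_nonneg_left (key a) (hP.1 a)
    _ = Real.cosh c := by
        simp only [mul_add, Finset.sum_add_distrib, ← mul_assoc, ← Finset.sum_mul, hP.2, hz]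
        ring
    _ ≤ _ := Real.cosh_le_exp_half_sq c

/-- Bounded differences. -/
def BD {k : ℕ} (f : (Fin k → α) → ℝ) (c : ℝ) : Prop :=
  ∀ x j a, |f (Function.update x j a) - f x| ≤ c

/-- McDiarmid-type bound on the moment generating function. -/
lemma mcdiarmid_mgf (P : α → ℝ) (hP : IsPMF P) (c : ℝ) (hc : 0 ≤ c) :
    ∀ (k : ℕ) (f : (Fin k → α) → ℝ), BD f c →
    Ex k P (fun x => Real.exp (f x - Ex k P f)) ≤ Real.exp (k * (c^2/2)) := by
  intro k
  induction k with
  | zero => intro f _; simp [Ex_zero]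
  | succ k ih =>
    intro f hf
    set g : α → ℝ := fun a => Ex k P (fun x => f (Fin.cons a x)) with hg
    have hE : Ex (k+1) P f = ∑ b, P b * g b := Ex_succ k P f
    rw [Ex_succ, hE]
    have h1 : ∀ a, Ex k P (fun x => Real.exp (f (Fin.cons a x) - ∑ b, P b * g b)) ≤
        Real.exp (g a - ∑ b, P b * g b) * Real.exp (k * (c^2/2)) := by
      intro a
      have hb : BD (fun x : Fin k → α => f (Fin.cons a x)) c := by
        intro x j b
        have := hf (Fin.cons a x) j.succ b
        simpa [Fin.cons_update] using this
      have h2 := ih _ hb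
      have : (fun x : Fin k → α => Real.exp (f (Fin.cons a x) - ∑ b, P b * g b)) =
          fun x => Real.exp (g a - ∑ b, P b * g b) * Real.exp (f (Fin.cons a x) - g a) := by
        funext x; rw [← Real.exp_add]; congr 1; ring
      rw [this, Ex_smul]
      exact mul_le_mul_of_nonneg_left h2 (Real.exp_pos _).le
    have hgd : ∀ a b, |g a - g b| ≤ c := by
      intro a b
      have hpt : ∀ x : Fin k → α, |f (Fin.cons a x) - f (Fin.cons b x)| ≤ c := by
        intro x
        have := hf (Fin.cons b x) 0 a
        simpa using this
      simp only [hg]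
      rw [← Ex_sub, abs_le]
      constructor
      · calc -c = Ex k P (fun _ => -c) := (Ex_const k P hP _).symm
          _ ≤ _ := Ex_mono k P hP _ _ fun x => (abs_le.mp (hpt x)).1
      · calc _ ≤ Ex k P (fun _ => c) := Ex_mono k P hP _ _ fun x => (abs_le.mp (hpt x)).2
          _ = c := Ex_const k P hP _
    calc _ ≤ ∑ a, P a * (Real.exp (g a - ∑ b, P b * g b) * Real.exp (k * (c^2/2))) :=
          Finset.sum_le_sum fun a _ => mul_le_mul_of_nonneg_left (h1 a) (hP.1 a)
      _ = (∑ a, P a * Real.exp (g a - ∑ b, P b * g b)) * Real.exp (k * (c^2/2)) := by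
          rw [Finset.sum_mul]; exact Finset.sum_congr rfl fun a _ => by ring
      _ ≤ Real.exp (c^2/2) * Real.exp (k * (c^2/2)) :=
          mul_le_mul_of_nonneg_right (single_mgf P hP g c hc hgd) (Real.exp_pos _).le
      _ = _ := by rw [← Real.exp_add]; congr 1; push_cast; ring

/-- McDiarmid tail bound (upper tail); apply to `-f` for the lower tail. -/
lemma mcdiarmid_tail (P : α → ℝ) (hP : IsPMF P) (c : ℝ) (hc : 0 < c) (k : ℕ) (hk : 0 < k)
    (f : (Fin k → α) → ℝ) (hf : BD f c) (τ : ℝ) (hτ : 0 ≤ τ) (h : (Fin k → α) → ℝ)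
    (hh : ∀ x, h x ≤ 1) (hh' : ∀ x, f x - Ex k P f < τ → h x ≤ 0) :
    Ex k P h ≤ Real.exp (-(τ^2 / (2 * c^2 * k))) := by
  have hk' : (0:ℝ) < k := by exact_mod_cast hk
  set l : ℝ := τ / (c^2 * k) with hl
  have hl0 : 0 ≤ l := by positivity
  have hb : BD (fun x => l * f x) (l * c) := by
    intro x j a
    rw [← mul_sub, abs_mul, abs_of_nonneg hl0]
    exact mul_le_mul_of_nonneg_left (hf x j a) hl0
  have h1 := mcdiarmid_mgf P hP (l*c) (by positivity) k _ hb
  rw [Ex_smul] at h1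
  have h2 : Ex k P h ≤ Ex k P (fun x => Real.exp (-(l*τ)) *
      Real.exp (l * f x - l * Ex k P f)) := by
    apply Ex_mono k P hP
    intro x
    rw [← Real.exp_add]
    by_cases hx : f x - Ex k P f < τ
    · exact (hh' x hx).trans (Real.exp_pos _).le
    · refine (hh x).trans (Real.one_le_exp ?_)
      have := mul_le_mul_of_nonneg_left (not_lt.mp hx) hl0
      linarith
  rw [Ex_smul] at h2
  refine h2.trans ((mul_le_mul_of_nonneg_left h1 (Real.exp_pos _).le).trans (le_of_eq ?_))
  rw [← Real.exp_add]
  congr 1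
  rw [hl]
  field_simp
  ring

end expectation

/-- Forward difference operator. -/
def Dl : Module.End ℝ (ℕ → ℝ) where
  toFun φ := fun s => φ (s+1) - φ s
  map_add' φ ψ := by funext s; simp; ring
  map_smul' c φ := by funext s; simp; ring

/-- Adding an independent Bernoulli(p) variable. -/
noncomputable def Tp (p : ℝ) : Module.End ℝ (ℕ → ℝ) := 1 + p • Dl

lemma Tp_apply (p : ℝ) (φ : ℕ → ℝ) (s : ℕ) : Tp p φ s = (1 - p) * φ s + p * φ (s+1) := by
  simp [Tp, Dl]; ring

lemma Tp_comm (p q : ℝ) : Commute (Tp p) (Tp q) := by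
  unfold Tp
  refine Commute.add_left (Commute.one_left _) ?_
  refine Commute.add_right (Commute.one_right _) ?_
  exact ((Commute.refl Dl).smul_left p).smul_right q

lemma Tp_pow_mono (p : ℝ) (h0 : 0 ≤ p) (h1 : p ≤ 1) (j : ℕ) (φ ψ : ℕ → ℝ)
    (h : ∀ s, φ s ≤ ψ s) : ∀ s, (Tp p ^ j) φ s ≤ (Tp p ^ j) ψ s := by
  induction j with
  | zero => simpa using h
  | succ j ih =>
    intro s
    rw [pow_succ', Module.End.mul_apply, Module.End.mul_apply, Tp_apply, Tp_apply]
    exact add_le_add (mul_le_mul_of_nonneg_left (ih s) (by linarith))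
      (mul_le_mul_of_nonneg_left (ih (s+1)) h0)

/-- Quadratic used in Chebyshev's inequality. -/
noncomputable def Qd (R c v : ℝ) : ℕ → ℝ := fun s => 1 - (((s:ℝ) - c)^2 + v) / R

lemma Tp_Qd (p R c v : ℝ) : Tp p (Qd R c v) = Qd R (c - p) (v + p * (1-p)) := by
  funext s
  rw [Tp_apply]
  simp only [Qd]
  push_cast
  ring

lemma Tp_pow_Qd (p R c v : ℝ) (j : ℕ) :
    (Tp p ^ j) (Qd R c v) = Qd R (c - j * p) (v + j * (p * (1-p))) := by
  induction j with
  | zero => simp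
  | succ j ih =>
    rw [pow_succ', Module.End.mul_apply, ih, Tp_Qd]
    push_cast
    congr 1 <;> ring

lemma hybrid (p q : ℝ) (m : ℕ) (φ : ℕ → ℝ) :
    (Tp q ^ m) φ 0 - (Tp p ^ m) φ 0 =
      (q - p) * ∑ j ∈ Finset.range m, (Tp q ^ j) ((Tp p ^ (m - 1 - j)) (Dl φ)) 0 := by
  have h := (Tp_comm q p).geom_sum₂_mul m
  have hd : Tp q - Tp p = (q - p) • Dl := by
    ext φ s; simp [Tp]; ring
  rw [hd] at h
  have h2 := congrArg (fun F : Module.End ℝ (ℕ → ℝ) => F φ 0) h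
  simp only [LinearMap.sub_apply, Pi.sub_apply] at h2
  rw [← h2]
  simp [Finset.mul_sum, LinearMap.sum_apply, Finset.sum_apply]

/-- Tail indicator. -/
noncomputable def tl (t : ℕ) : ℕ → ℝ := fun s => if t < s then 1 else 0

set_option maxHeartbeats 1000000 in
lemma coord_lower (m : ℕ) (p q : ℝ) (hp : 0 ≤ p) (hpq : p ≤ q) (hq : q ≤ 1) :
    (m * (q - p))^2 / (16 * (m * (q-p) + (1 + √(m * q)))) ≤
      ∑ t ∈ Finset.range (3*m+3), ((Tp q ^ m) (tl t) 0 - (Tp p ^ m) (tl t) 0)^2 := by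
  have hm0 : (0:ℝ) ≤ m := Nat.cast_nonneg m
  set a : ℝ := m * (q - p) with ha
  have ha0 : 0 ≤ a := mul_nonneg hm0 (by linarith)
  have ham : a ≤ m := by nlinarith
  have hmq0 : 0 ≤ m * q := mul_nonneg hm0 (by linarith)
  have hmq : m * q ≤ m := by nlinarith
  set R : ℝ := 2 * ((a+1)^2 + m * q) with hR
  have hR0 : 0 < R := by positivity
  set r : ℝ := √R with hr
  have hr2 : r^2 = R := Real.sq_sqrt hR0.le
  have hr0 : 0 < r := Real.sqrt_pos.mpr hR0
  set c : ℝ := m * p with hc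
  have hc0 : 0 ≤ c := mul_nonneg hm0 hp
  have hcm : c ≤ m := by nlinarith
  have hrm : r ≤ 2 * (m+1) := by
    apply Real.sqrt_le_iff.mpr
    constructor
    · positivity
    · nlinarith
  set I : Finset ℕ := Finset.Ico ⌈c - r⌉₊ ⌈c + r⌉₊ with hI
  have hIsub : I ⊆ Finset.range (3*m+3) := by
    intro t ht
    rw [hI, Finset.mem_Ico, Nat.lt_ceil] at ht
    rw [Finset.mem_range]
    have : (t:ℝ) < ((3*m+3 : ℕ):ℝ) := by push_cast; linarith [ht.2]
    exact_mod_cast this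
  have hIcard : (I.card : ℝ) ≤ 4 * (a + (1 + √(m*q))) := by
    have h1 : (I.card : ℝ) ≤ 2 * r + 1 := by
      rw [hI, Nat.card_Ico]
      have e1 := Nat.ceil_lt_add_one (show 0 ≤ c + r by linarith)
      have e2 := Nat.le_ceil (c - r)
      have e3 : ⌈c - r⌉₊ ≤ ⌈c + r⌉₊ := Nat.ceil_mono (by linarith)
      rw [Nat.cast_sub e3]
      linarith
    have h2 : r ≤ 3/2 * (a + 1 + √(m*q)) := by
      apply Real.sqrt_le_iff.mpr
      have hs := Real.sq_sqrt hmq0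
      have hs0 := Real.sqrt_nonneg (m*q)
      constructor
      · positivity
      · rw [hR]; nlinarith [mul_nonneg ha0 hs0]
    have hs0 := Real.sqrt_nonneg (m*q)
    linarith
  set φ : ℕ → ℝ := ∑ t ∈ I, tl t with hφ
  have hDl : ∀ s, Qd R c 0 s ≤ Dl φ s := by
    intro s
    have e : Dl φ s = if s ∈ I then 1 else 0 := by
      have : Dl φ s = ∑ t ∈ I, if s = t then (1:ℝ) else 0 := by
        simp only [Dl, hφ, LinearMap.coe_mk, AddHom.coe_mk, Finset.sum_apply, tl]
        rw [← Finset.sum_sub_distrib]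
        refine Finset.sum_congr rfl fun t _ => ?_
        split_ifs <;> first | omega | norm_num
      rw [this, Finset.sum_ite_eq]
    rw [e]
    simp only [Qd, add_zero]
    split_ifs with hs
    · have : 0 ≤ ((s:ℝ) - c)^2 / R := by positivity
      linarith
    · have : 1 ≤ ((s:ℝ) - c)^2 / R := by
        rw [le_div_iff₀ hR0, one_mul, ← hr2]
        rw [hI, Finset.mem_Ico, not_and_or, not_le, not_lt, Nat.lt_ceil, Nat.ceil_le] at hs
        rcases hs with hs | hs <;> nlinarith
      linarith
  have hsum : a / 2 ≤ ∑ t ∈ I, ((Tp q ^ m) (tl t) 0 - (Tp p ^ m) (tl t) 0) := by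
    have e : ∑ t ∈ I, ((Tp q ^ m) (tl t) 0 - (Tp p ^ m) (tl t) 0) =
        (Tp q ^ m) φ 0 - (Tp p ^ m) φ 0 := by
      rw [hφ, map_sum, map_sum, Finset.sum_apply, Finset.sum_apply, Finset.sum_sub_distrib]
    rw [e, hybrid]
    have hj : ∀ j ∈ Finset.range m,
        (1/2 : ℝ) ≤ (Tp q ^ j) ((Tp p ^ (m - 1 - j)) (Dl φ)) 0 := by
      intro j hj
      rw [Finset.mem_range] at hj
      have h1 := Tp_pow_mono q (by linarith) hq j _ _
        (Tp_pow_mono p hp (by linarith) (m-1-j) _ _ hDl) 0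
      refine le_trans ?_ h1
      rw [Tp_pow_Qd, Tp_pow_Qd]
      simp only [Qd]
      obtain ⟨l, rfl⟩ : ∃ l, m = j + 1 + l := ⟨m - (j+1), by omega⟩
      have : j + 1 + l - 1 - j = l := by omega
      rw [this]
      have hcj : ((0:ℕ):ℝ) - (c - l * p - j * q) = j * (q - p) - p := by
        rw [hc]; push_cast; ring
      rw [hcj]
      have hj0 : (0:ℝ) ≤ j := Nat.cast_nonneg j
      have hl0 : (0:ℝ) ≤ l := Nat.cast_nonneg l
      have b1 : (j * (q - p) - p)^2 ≤ (a+1)^2 := by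
        apply sq_le_sq'
        · have : 0 ≤ j * (q - p) := mul_nonneg hj0 (by linarith)
          linarith
        · have : j * (q - p) ≤ a := by
            rw [ha]
            exact mul_le_mul_of_nonneg_right (by push_cast; linarith) (by linarith)
          linarith
      have b2 : 0 + l * (p * (1-p)) + j * (q * (1 - q)) ≤ ((j+1+l : ℕ):ℝ) * q := by
        push_cast
        have u1 : p * (1-p) ≤ q := by nlinarith only [hp, hpq]
        have u2 : q * (1-q) ≤ q := by nlinarith only [hp, hpq]
        have u3 := mul_le_mul_of_nonneg_left u1 hl0
        have u4 := mul_le_mul_of_nonneg_left u2 hj0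
        linarith
      have : ((j * (q - p) - p)^2 + (0 + l * (p * (1-p)) + j * (q * (1 - q)))) / R ≤ 1/2 := by
        rw [div_le_iff₀ hR0, hR]
        linarith
      linarith
    have := Finset.card_nsmul_le_sum _ _ _ hj
    rw [Finset.card_range, nsmul_eq_mul] at this
    have h3 := mul_le_mul_of_nonneg_left this (sub_nonneg.mpr hpq)
    refine le_trans (le_of_eq ?_) h3
    rw [ha]; ring
  have hcs := sq_sum_le_card_mul_sum_sq (s := I)
    (f := fun t => (Tp q ^ m) (tl t) 0 - (Tp p ^ m) (tl t) 0)
  have hmon : ∑ t ∈ I, ((Tp q ^ m) (tl t) 0 - (Tp p ^ m) (tl t) 0)^2 ≤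
      ∑ t ∈ Finset.range (3*m+3), ((Tp q ^ m) (tl t) 0 - (Tp p ^ m) (tl t) 0)^2 :=
    Finset.sum_le_sum_of_subset_of_nonneg hIsub fun _ _ _ => sq_nonneg _
  refine le_trans ?_ hmon
  have hs0 := Real.sqrt_nonneg (m*q)
  rw [div_le_iff₀ (by positivity)]
  have hsq : (a/2)^2 ≤ (∑ t ∈ I, ((Tp q ^ m) (tl t) 0 - (Tp p ^ m) (tl t) 0))^2 :=
    pow_le_pow_left₀ (by positivity) hsum 2
  have hnn : 0 ≤ ∑ t ∈ I, ((Tp q ^ m) (tl t) 0 - (Tp p ^ m) (tl t) 0)^2 :=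
    Finset.sum_nonneg fun _ _ => sq_nonneg _
  have := mul_le_mul_of_nonneg_right hIcard hnn
  nlinarith

lemma coord_lower' (m : ℕ) (p q : ℝ) (hp : 0 ≤ p) (hp1 : p ≤ 1) (hq0 : 0 ≤ q) (hq : q ≤ 1) :
    (m * |p - q|)^2 / (16 * (m * |p - q| + (1 + √(m * (p + q))))) ≤
      ∑ t ∈ Finset.range (3*m+3), ((Tp p ^ m) (tl t) 0 - (Tp q ^ m) (tl t) 0)^2 := by
  have hm0 : (0:ℝ) ≤ m := Nat.cast_nonneg m
  rcases le_total p q with h | h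
  · have h1 := coord_lower m p q hp h hq
    rw [abs_sub_comm, abs_of_nonneg (sub_nonneg.mpr h)]
    have e : ∀ t, ((Tp p ^ m) (tl t) 0 - (Tp q ^ m) (tl t) 0)^2 =
      ((Tp q ^ m) (tl t) 0 - (Tp p ^ m) (tl t) 0)^2 := fun t => by ring
    simp only [e]
    refine le_trans ?_ h1
    have : 0 ≤ m * (q-p) := mul_nonneg hm0 (by linarith)
    gcongr
    linarith
  · have h1 := coord_lower m q p hq0 h hp1
    rw [abs_of_nonneg (sub_nonneg.mpr h)]
    refine le_trans ?_ h1
    have : 0 ≤ m * (p-q) := mul_nonneg hm0 (by linarith)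
    gcongr
    linarith

/-- The number of occurrences of `i` in the sample `x`. -/
def cnt {n m : ℕ} (x : Fin m → Fin n) (i : Fin n) : ℕ := ∑ j, if x j = i then 1 else 0

lemma Ex_count {β : Type*} [Fintype β] (P : β → ℝ) (hP : IsPMF P) (e : β → Prop)
    [DecidablePred e] (p : ℝ) (hp : ∑ b, P b * (if e b then 1 else 0) = p) (φ : ℕ → ℝ) (m : ℕ) :
    ∀ s : ℕ, Ex m P (fun z => φ (s + ∑ j, if e (z j) then 1 else 0)) = (Tp p ^ m) φ s := by
  induction m with
  | zero => intro s; simp [Ex_zero]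
  | succ m ih =>
    intro s
    rw [Ex_succ, pow_succ', Module.End.mul_apply, Tp_apply]
    have h1 : ∀ a, Ex m P (fun x => φ (s + ∑ j, if e ((Fin.cons a x : Fin (m+1) → β) j)
        then 1 else 0)) = (Tp p ^ m) φ (s + if e a then 1 else 0) := by
      intro a
      rw [← ih]
      simp only [Fin.sum_univ_succ, Fin.cons_zero, Fin.cons_succ, add_assoc]
    simp only [h1]
    set ψ := (Tp p ^ m) φ
    have h2 : ∀ a, P a * ψ (s + if e a then 1 else 0) =
        P a * ψ s + (P a * (if e a then 1 else 0)) * (ψ (s+1) - ψ s) := by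
      intro a; split_ifs <;> simp; ring
    simp only [h2]
    rw [Finset.sum_add_distrib, ← Finset.sum_mul, ← Finset.sum_mul, hp, hP.2]
    ring

/-- Difference of tail indicators of the counts. -/
noncomputable def Dst {n m : ℕ} (z : Fin m → Fin n × Fin n) (i : Fin n) (t : ℕ) : ℝ :=
  tl t (cnt (fun j => (z j).1) i) - tl t (cnt (fun j => (z j).2) i)

lemma abs_Dst_le {n m : ℕ} (z : Fin m → Fin n × Fin n) (i : Fin n) (t : ℕ) :
    |Dst z i t| ≤ 1 := by
  unfold Dst tl; split_ifs <;> simp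

lemma Ex_Dst {n m : ℕ} (p q : Fin n → ℝ) (hp : IsPMF p) (hq : IsPMF q)
    (hP : IsPMF (fun a : Fin n × Fin n => p a.1 * q a.2)) (i : Fin n) (t : ℕ) :
    Ex m (fun a : Fin n × Fin n => p a.1 * q a.2) (fun z => Dst z i t) =
      (Tp (p i) ^ m) (tl t) 0 - (Tp (q i) ^ m) (tl t) 0 := by
  unfold Dst
  rw [Ex_sub]
  congr 1
  · rw [← Ex_count _ hP (fun a => a.1 = i) (p i) ?_ (tl t) m 0]
    · simp [cnt]
    · rw [Fintype.sum_prod_type]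
      simp only [mul_ite, mul_one, mul_zero]
      rw [Finset.sum_eq_single i]
      · simp [← Finset.mul_sum, hq.2]
      · intro b _ hb; simp [hb]
      · simp
  · rw [← Ex_count _ hP (fun a => a.2 = i) (q i) ?_ (tl t) m 0]
    · simp [cnt]
    · rw [Fintype.sum_prod_type_right]
      simp only [mul_ite, mul_one, mul_zero]
      rw [Finset.sum_eq_single i]
      · simp [← Finset.sum_mul, hp.2]
      · intro b _ hb; simp [hb]
      · simp

lemma isPMF_prod {n : ℕ} (p q : Fin n → ℝ) (hp : IsPMF p) (hq : IsPMF q) :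
    IsPMF (fun a : Fin n × Fin n => p a.1 * q a.2) := by
  refine ⟨fun a => mul_nonneg (hp.1 _) (hq.1 _), ?_⟩
  rw [Fintype.sum_prod_type]
  simp only [← Finset.mul_sum, hq.2, mul_one, hp.2]

lemma sum_tl_diff_le (M : ℕ) (u v : ℕ) :
    ∑ t ∈ Finset.range M, |tl t u - tl t v| ≤ |(u:ℝ) - v| := by
  wlog h : v ≤ u generalizing u v with H
  · have := H v u (by omega)
    simpa only [abs_sub_comm] using this
  have e : ∀ t, |tl t u - tl t v| = if t ∈ Finset.Ico v u then (1:ℝ) else 0 := by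
    intro t
    unfold tl
    simp only [Finset.mem_Ico]
    split_ifs <;> first | omega | norm_num
  simp only [e]
  rw [Finset.sum_ite_mem, Finset.sum_const, nsmul_eq_mul, mul_one,
    abs_of_nonneg (by rw [sub_nonneg]; exact_mod_cast h)]
  calc ((Finset.range M ∩ Finset.Ico v u).card : ℝ) ≤ ((Finset.Ico v u).card : ℝ) := by
        exact_mod_cast Finset.card_le_card Finset.inter_subset_right
    _ = (u:ℝ) - v := by rw [Nat.card_Ico, Nat.cast_sub h]

lemma cnt_update {n m : ℕ} (x : Fin m → Fin n) (j : Fin m) (a : Fin n) :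
    ∑ i, |(cnt (Function.update x j a) i : ℝ) - cnt x i| ≤ 2 := by
  have e : ∀ i, (cnt (Function.update x j a) i : ℝ) - cnt x i =
      (if a = i then 1 else 0) - (if x j = i then 1 else 0) := by
    intro i
    unfold cnt
    push_cast
    rw [← Finset.sum_sub_distrib, Finset.sum_eq_single j]
    · simp
    · intro b _ hb; simp [hb]
    · simp
  calc _ ≤ ∑ i, ((if a = i then (1:ℝ) else 0) + (if x j = i then 1 else 0)) := by
        refine Finset.sum_le_sum fun i _ => ?_
        rw [e]
        split_ifs <;> norm_num
    _ = 2 := by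
        rw [Finset.sum_add_distrib]; simp; norm_num

lemma Dst_update {n m : ℕ} (M : ℕ) (z : Fin m → Fin n × Fin n) (j : Fin m) (a : Fin n × Fin n) :
    ∑ i, ∑ t ∈ Finset.range M, |Dst (Function.update z j a) i t - Dst z i t| ≤ 4 := by
  have e1 : (fun j' => (Function.update z j a j').1) =
      Function.update (fun j' => (z j').1) j a.1 := by
    funext j'; by_cases h : j' = j
    · subst h; simp
    · simp [h]
  have e2 : (fun j' => (Function.update z j a j').2) =
      Function.update (fun j' => (z j').2) j a.2 := by
    funext j'; by_cases h : j' = j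
    · subst h; simp
    · simp [h]
  have h1 := cnt_update (fun j' => (z j').1) j a.1
  have h2 := cnt_update (fun j' => (z j').2) j a.2
  have h3 : ∀ i, ∑ t ∈ Finset.range M, |Dst (Function.update z j a) i t - Dst z i t| ≤
      |(cnt (Function.update (fun j' => (z j').1) j a.1) i : ℝ) - cnt (fun j' => (z j').1) i| +
      |(cnt (Function.update (fun j' => (z j').2) j a.2) i : ℝ) - cnt (fun j' => (z j').2) i| := by
    intro i
    refine le_trans ?_ (add_le_add (sum_tl_diff_le M _ _) (sum_tl_diff_le M _ _))
    rw [← Finset.sum_add_distrib]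
    refine Finset.sum_le_sum fun t _ => ?_
    unfold Dst
    rw [e1, e2]
    refine le_trans (le_of_eq ?_) (abs_sub _ _)
    congr 1; ring
  refine (Finset.sum_le_sum fun i _ => h3 i).trans ?_
  rw [Finset.sum_add_distrib]
  linarith

/-- First block of the sample. -/
def blk1 {α : Type*} {m r : ℕ} (z : Fin (m + (m + r)) → α) : Fin m → α :=
  fun j => z (Fin.castAdd (m + r) j)

/-- Second block of the sample. -/
def blk2 {α : Type*} {m r : ℕ} (z : Fin (m + (m + r)) → α) : Fin m → α :=
  fun j => z (Fin.natAdd m (Fin.castAdd r j))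

/-- The test statistic. -/
noncomputable def Zst {n m r : ℕ} (z : Fin (m + (m + r)) → Fin n × Fin n) : ℝ :=
  ∑ i, ∑ t ∈ Finset.range (3*m+3), Dst (blk1 z) i t * Dst (blk2 z) i t

lemma Zst_BD {n m r : ℕ} : BD (Zst (n := n) (m := m) (r := r)) 4 := by
  intro z j a
  have key : |Zst (Function.update z j a) - Zst z| ≤
      ∑ i, ∑ t ∈ Finset.range (3*m+3),
        |Dst (blk1 (Function.update z j a)) i t - Dst (blk1 z) i t| +
      ∑ i, ∑ t ∈ Finset.range (3*m+3),
        |Dst (blk2 (Function.update z j a)) i t - Dst (blk2 z) i t| := by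
    unfold Zst
    simp only [← Finset.sum_sub_distrib, ← Finset.sum_add_distrib]
    refine (Finset.abs_sum_le_sum_abs _ _).trans (Finset.sum_le_sum fun i _ => ?_)
    refine (Finset.abs_sum_le_sum_abs _ _).trans (Finset.sum_le_sum fun t _ => ?_)
    have a1 := abs_Dst_le (blk2 (Function.update z j a)) i t
    have a2 := abs_Dst_le (blk1 z) i t
    generalize Dst (blk1 (Function.update z j a)) i t = A at *
    generalize Dst (blk2 (Function.update z j a)) i t = B at *
    generalize Dst (blk1 z) i t = A' at *
    generalize Dst (blk2 z) i t = B' at *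
    have : A * B - A' * B' = (A - A') * B + A' * (B - B') := by ring
    rw [this]
    refine (abs_add_le _ _).trans ?_
    rw [abs_mul, abs_mul]
    exact add_le_add (mul_le_of_le_one_right (abs_nonneg _) a1)
      (mul_le_of_le_one_left (abs_nonneg _) a2)
  refine key.trans ?_
  refine Fin.addCases (fun j' => ?_) (fun j' => ?_) j
  · have e1 : blk1 (Function.update z (Fin.castAdd (m+r) j') a) =
        Function.update (blk1 z) j' a := by
      funext l; unfold blk1; simp [Function.update_apply]
    have e2 : blk2 (Function.update z (Fin.castAdd (m+r) j') a) = blk2 z := by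
      funext l; unfold blk2
      rw [Function.update_of_ne]
      intro h; have := congrArg Fin.val h; simp at this; omega
    rw [e1, e2]
    simpa using Dst_update (3*m+3) (blk1 z) j' a
  · have e1 : blk1 (Function.update z (Fin.natAdd m j') a) = blk1 z := by
      funext l; unfold blk1
      rw [Function.update_of_ne]
      intro h; have := congrArg Fin.val h; simp at this; omega
    rw [e1]
    refine Fin.addCases (fun l => ?_) (fun l => ?_) j'
    · have e2 : blk2 (Function.update z (Fin.natAdd m (Fin.castAdd r l)) a) =
          Function.update (blk2 z) l a := by
        funext l; unfold blk2; simp [Function.update_apply]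
      rw [e2]
      simpa using Dst_update (3*m+3) (blk2 z) l a
    · have e2 : blk2 (Function.update z (Fin.natAdd m (Fin.natAdd m l)) a) = blk2 z := by
        funext l; unfold blk2
        rw [Function.update_of_ne]
        intro h; have := congrArg Fin.val h; simp at this; omega
      rw [e2]
      simp

lemma Ex_Zst {n m r : ℕ} (P : Fin n × Fin n → ℝ) (hP : IsPMF P) :
    Ex (m + (m + r)) P (Zst (n := n) (m := m) (r := r)) =
      ∑ i, ∑ t ∈ Finset.range (3*m+3), (Ex m P (fun z => Dst z i t))^2 := by
  unfold Zst
  rw [Ex_sum]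
  refine Finset.sum_congr rfl fun i _ => ?_
  rw [Ex_sum]
  refine Finset.sum_congr rfl fun t _ => ?_
  rw [Ex_append]
  have b1 : ∀ (x : Fin m → Fin n × Fin n) (y : Fin (m+r) → Fin n × Fin n),
      blk1 (Fin.append x y) = x := by
    intro x y; funext j; simp [blk1]
  have b2 : ∀ (x : Fin m → Fin n × Fin n) (y : Fin m → Fin n × Fin n)
      (w : Fin r → Fin n × Fin n),
      blk2 (Fin.append x (Fin.append y w)) = y := by
    intro x y w; funext j; simp [blk2]
  simp only [Ex_append, b1, b2, Ex_const _ P hP, Ex_smul, Ex_smul_right]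
  ring

lemma acceptProb_eq {n k : ℕ} (p q : Fin n → ℝ) (A : (Fin k → Fin n) → (Fin k → Fin n) → ℝ) :
    acceptProb p q A = Ex k (fun a : Fin n × Fin n => p a.1 * q a.2)
      (fun z => A (fun j => (z j).1) (fun j => (z j).2)) := by
  unfold acceptProb Ex
  rw [← Fintype.sum_prod_type' (f := fun x y => (∏ i, p (x i)) * (∏ i, q (y i)) * A x y),
    ← (Equiv.arrowProdEquivProdArrow (Fin k) (fun _ => Fin n) (fun _ => Fin n)).sum_comp]
  refine Finset.sum_congr rfl fun z _ => ?_
  simp [Equiv.arrowProdEquivProdArrow, Finset.prod_mul_distrib]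

lemma Ex_Zst_lower {n m r : ℕ} (p q : Fin n → ℝ) (hp : IsPMF p) (hq : IsPMF q)
    (hn : 1 ≤ n) :
    (2 * m * tvDist p q)^2 / (16 * (2 * m * tvDist p q + (n + √(2 * m * n)))) ≤
    Ex (m + (m + r)) (fun a : Fin n × Fin n => p a.1 * q a.2)
      (Zst (n := n) (m := m) (r := r)) := by
  have hP := isPMF_prod p q hp hq
  have hm0 : (0:ℝ) ≤ m := Nat.cast_nonneg m
  have le1 : ∀ (p : Fin n → ℝ), IsPMF p → ∀ i, p i ≤ 1 := by
    intro p hp i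
    rw [← hp.2]
    exact Finset.single_le_sum (fun j _ => hp.1 j) (Finset.mem_univ i)
  rw [Ex_Zst _ hP]
  simp only [Ex_Dst p q hp hq hP]
  refine le_trans ?_ (Finset.sum_le_sum fun i _ =>
    coord_lower' m (p i) (q i) (hp.1 i) (le1 p hp i) (hq.1 i) (le1 q hq i))
  have titu := Finset.sq_sum_div_le_sum_sq_div (Finset.univ : Finset (Fin n))
    (fun i => m * |p i - q i|) (g := fun i => 16 * (m * |p i - q i| + (1 + √(m * (p i + q i)))))
    (fun i _ => by positivity)
  refine le_trans ?_ titu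
  have hT : ∑ i, (m:ℝ) * |p i - q i| = 2 * m * tvDist p q := by
    rw [← Finset.mul_sum]; unfold tvDist; ring
  have hT0 : 0 ≤ 2 * m * tvDist p q := by
    rw [← hT]; exact Finset.sum_nonneg fun i _ => by positivity
  have hS : ∑ i, √((m:ℝ) * (p i + q i)) ≤ √(2 * m * n) := by
    apply Real.le_sqrt_of_sq_le
    refine (sq_sum_le_card_mul_sum_sq).trans (le_of_eq ?_)
    have : ∀ i, √((m:ℝ) * (p i + q i))^2 = m * (p i + q i) := fun i =>
      Real.sq_sqrt (mul_nonneg hm0 (add_nonneg (hp.1 i) (hq.1 i)))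
    simp only [this]
    rw [← Finset.mul_sum, Finset.sum_add_distrib, hp.2, hq.2]
    simp; ring
  have hden : ∑ i, 16 * ((m:ℝ) * |p i - q i| + (1 + √(m * (p i + q i)))) ≤
      16 * (2 * m * tvDist p q + (n + √(2 * m * n))) := by
    rw [← Finset.mul_sum, Finset.sum_add_distrib, Finset.sum_add_distrib, hT]
    simp only [Finset.sum_const, Finset.card_univ, Fintype.card_fin, nsmul_eq_mul, mul_one]
    linarith
  rw [hT]
  have hpos : 0 < ∑ i, 16 * ((m:ℝ) * |p i - q i| + (1 + √(m * (p i + q i)))) := by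
    have : Nonempty (Fin n) := ⟨⟨0, hn⟩⟩
    exact Finset.sum_pos (fun i _ => by positivity) Finset.univ_nonempty
  exact div_le_div_of_nonneg_left (sq_nonneg _) hpos hden

lemma le_of_sq_le_sq_aux {a b : ℝ} (hb : 0 ≤ b) (h : a^2 ≤ b^2) : a ≤ b :=
  (abs_le_of_sq_le_sq' h hb).2

/-- The final numerical inequality. -/
lemma numeric (m k n L ε T τ : ℝ) (hm : 0 < m) (hn : 0 < n) (hL : 0 < L) (hε : 0 < ε)
    (hk0 : 0 < k) (hk : k ≤ 3 * m) (h1 : 10^6 * L ≤ k * ε^2)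
    (h2 : (10^6)^3 * (n^2 * L) ≤ k^3 * ε^4) (h3 : (10^6)^2 * (n * L) ≤ k^2 * ε^4)
    (hT : 2 * m * ε ≤ T) (hτ2 : τ^2 = 32 * k * L) :
    2 * τ ≤ T^2 / (16 * (T + (n + √(2 * m * n)))) := by
  have hT0 : 0 < T := lt_of_lt_of_le (by positivity) hT
  have hs0 := Real.sqrt_nonneg (2*m*n)
  have hs2 : √(2*m*n)^2 = 2*m*n := Real.sq_sqrt (by positivity)
  set s := √(2*m*n)
  have hTsq : 4 * m^2 * ε^2 ≤ T^2 := by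
    have := pow_le_pow_left₀ (by positivity) hT 2
    linarith [this, (by ring : (2*m*ε)^2 = 4*m^2*ε^2)]
  have hT4 : 16 * m^4 * ε^4 ≤ (T^2)^2 := by
    have := pow_le_pow_left₀ (by positivity) hTsq 2
    linarith [this, (by ring : (4 * m^2 * ε^2)^2 = 16*m^4*ε^4)]
  have hτ3 : τ^2 ≤ 96 * m * L := by
    rw [hτ2]; nlinarith
  have k2 : k^2 ≤ 9 * m^2 := by
    have := pow_le_pow_left₀ hk0.le hk 2
    linarith [this, (by ring : (3*m)^2 = 9*m^2)]
  have k3 : k^3 ≤ 27 * m^3 := by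
    have := pow_le_pow_left₀ hk0.le hk 3
    linarith [this, (by ring : (3*m)^3 = 27*m^3)]
  have m1 : 10^6 * L ≤ 3 * m * ε^2 := h1.trans (mul_le_mul_of_nonneg_right hk (by positivity))
  have m2 : (10^6)^2 * (n*L) ≤ 9 * m^2 * ε^4 :=
    h3.trans (mul_le_mul_of_nonneg_right k2 (by positivity))
  have m3 : (10^6)^3 * (n^2*L) ≤ 27 * m^3 * ε^4 :=
    h2.trans (mul_le_mul_of_nonneg_right k3 (by positivity))
  have a1 : 96 * τ ≤ T := by
    refine le_of_sq_le_sq_aux hT0.le ?_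
    have := mul_le_mul_of_nonneg_left m1 hm.le
    nlinarith
  have a2 : 96 * (τ * n) ≤ T^2 := by
    refine le_of_sq_le_sq_aux (by positivity) ?_
    have e1 := mul_le_mul_of_nonneg_left m3 hm.le
    have e2 := mul_le_mul_of_nonneg_right hτ3 (sq_nonneg n)
    have : 0 ≤ m * (n^2 * L) := by positivity
    refine le_trans ?_ hT4
    nlinarith
  have a3 : 96 * (τ * s) ≤ T^2 := by
    refine le_of_sq_le_sq_aux (by positivity) ?_
    have e1 := mul_le_mul_of_nonneg_left m2 (sq_nonneg m)
    have e2 := mul_le_mul_of_nonneg_right hτ3 (sq_nonneg s)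
    have e3 : (96 * (τ * s))^2 = 96^2 * (τ^2 * s^2) := by ring
    have : 0 ≤ m^2 * (n * L) := by positivity
    refine le_trans ?_ hT4
    rw [e3]
    rw [hs2] at e2 ⊢
    nlinarith
  rw [le_div_iff₀ (by positivity)]
  have a1' := mul_le_mul_of_nonneg_right a1 hT0.le
  nlinarith

/-- Closeness testing upper bound (Theorem 1.2, upper-bound part). -/
theorem closeness_testing_upper_bound :
    ∃ C > (0 : ℝ), ∃ C' > (0 : ℝ), ∀ n : ℕ, 1 ≤ n →
      ∀ ε δ : ℝ, 0 < ε → ε < 1 → 0 < δ → δ < 1 →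
      ∀ k : ℕ,
        k = ⌈C * ((n : ℝ) ^ ((2 : ℝ) / 3) * Real.log (1 / δ) ^ ((1 : ℝ) / 3) / ε ^ ((4 : ℝ) / 3)
              + ((n : ℝ) ^ ((1 : ℝ) / 2) * Real.log (1 / δ) ^ ((1 : ℝ) / 2)
                  + Real.log (1 / δ)) / ε ^ 2)⌉₊ →
        ∃ A : (Fin k → Fin n) → (Fin k → Fin n) → ℝ,
          (∀ x y, 0 ≤ A x y ∧ A x y ≤ 1) ∧
          ∀ p q : Fin n → ℝ, IsPMF p → IsPMF q →
            (p = q → 1 - δ ≤ acceptProb p q A) ∧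
            (ε ≤ tvDist p q → acceptProb p q A ≤ δ) := by
  refine ⟨10^6, by norm_num, 1, one_pos, ?_⟩
  intro n hn ε δ hε hε1 hδ hδ1 k hk
  by_cases hδ2 : 1/2 ≤ δ
  · -- trivial tester
    refine ⟨fun _ _ => 1/2, fun _ _ => by norm_num, fun p q hp hq => ?_⟩
    rw [acceptProb_eq, Ex_const _ _ (isPMF_prod p q hp hq)]
    exact ⟨fun _ => by linarith, fun _ => hδ2⟩
  rw [not_le] at hδ2
  have hn0 : (0:ℝ) < n := by exact_mod_cast hn
  set L := Real.log (1/δ) with hL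
  have hL2 : 0.69 ≤ L := by
    have h1 : Real.log 2 ≤ L := Real.log_le_log (by norm_num) (by
      rw [le_div_iff₀ hδ]; linarith)
    linarith [Real.log_two_gt_d9]
  have hL0 : 0 < L := by linarith
  have hδL : Real.exp (-L) = δ := by
    rw [hL, one_div, Real.log_inv, neg_neg, Real.exp_log hδ]
  -- consequences of the choice of k
  have hkge := Nat.le_ceil ((10:ℝ)^6 * ((n : ℝ) ^ ((2 : ℝ) / 3) * L ^ ((1 : ℝ) / 3)
    / ε ^ ((4 : ℝ) / 3) + ((n : ℝ) ^ ((1 : ℝ) / 2) * L ^ ((1 : ℝ) / 2) + L) / ε ^ 2))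
  rw [← hk] at hkge
  have hu3 : ((n:ℝ) ^ ((2 : ℝ) / 3))^3 = (n:ℝ)^2 := by
    rw [← Real.rpow_natCast, ← Real.rpow_mul hn0.le, ← Real.rpow_natCast]; norm_num
  have hv3 : (L ^ ((1 : ℝ) / 3))^3 = L := by
    rw [← Real.rpow_natCast, ← Real.rpow_mul hL0.le]; norm_num
  have he3 : (ε ^ ((4 : ℝ) / 3))^3 = ε^4 := by
    rw [← Real.rpow_natCast, ← Real.rpow_mul hε.le, ← Real.rpow_natCast]; norm_num
  have hs2 : ((n:ℝ) ^ ((1 : ℝ) / 2))^2 = (n:ℝ) := by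
    rw [← Real.rpow_natCast, ← Real.rpow_mul hn0.le]; norm_num
  have hl2 : (L ^ ((1 : ℝ) / 2))^2 = L := by
    rw [← Real.rpow_natCast, ← Real.rpow_mul hL0.le]; norm_num
  have hu0 : 0 < (n:ℝ) ^ ((2 : ℝ) / 3) := Real.rpow_pos_of_pos hn0 _
  have hv0 : 0 < L ^ ((1 : ℝ) / 3) := Real.rpow_pos_of_pos hL0 _
  have he0 : 0 < ε ^ ((4 : ℝ) / 3) := Real.rpow_pos_of_pos hε _
  have hs0 : 0 < (n:ℝ) ^ ((1 : ℝ) / 2) := Real.rpow_pos_of_pos hn0 _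
  have hl0 : 0 < L ^ ((1 : ℝ) / 2) := Real.rpow_pos_of_pos hL0 _
  generalize (n:ℝ) ^ ((2 : ℝ) / 3) = u at *
  generalize L ^ ((1 : ℝ) / 3) = v at *
  generalize ε ^ ((4 : ℝ) / 3) = e at *
  generalize (n:ℝ) ^ ((1 : ℝ) / 2) = s at *
  generalize L ^ ((1 : ℝ) / 2) = l at *
  have hε2 : 0 < ε^2 := by positivity
  have A1 : 10^6 * (u * v) ≤ k * e := by
    have h0 : 0 ≤ (s * l + L) / ε^2 := by positivity
    have : 10^6 * (u * v / e) ≤ k := by linarith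
    calc 10^6 * (u * v) = 10^6 * (u * v / e) * e := by field_simp
      _ ≤ k * e := mul_le_mul_of_nonneg_right this he0.le
  have A0 : 10^6 * (s * l + L) ≤ k * ε^2 := by
    have h0 : 0 ≤ u * v / e := by positivity
    have : 10^6 * ((s * l + L) / ε^2) ≤ k := by linarith
    calc 10^6 * (s * l + L) = 10^6 * ((s * l + L) / ε^2) * ε^2 := by field_simp
      _ ≤ k * ε^2 := mul_le_mul_of_nonneg_right this hε2.le
  have A2 : 10^6 * (s * l) ≤ k * ε^2 := by linarith
  have A3 : 10^6 * L ≤ k * ε^2 := by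
    have : 0 < s * l := by positivity
    linarith
  have B1 : (10^6)^3 * ((n:ℝ)^2 * L) ≤ (k:ℝ)^3 * ε^4 := by
    have := pow_le_pow_left₀ (by positivity) A1 3
    rw [mul_pow, mul_pow, mul_pow, hu3, hv3, he3] at this
    exact this
  have B2 : (10^6)^2 * ((n:ℝ) * L) ≤ (k:ℝ)^2 * ε^4 := by
    have := pow_le_pow_left₀ (by positivity) A2 2
    rw [mul_pow, mul_pow, mul_pow, hs2, hl2, ← pow_mul ε] at this
    exact this
  have hk2 : 2 ≤ k := by
    have h1 : (k:ℝ) * ε^2 ≤ k * 1 :=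
      mul_le_mul_of_nonneg_left (pow_le_one₀ hε.le hε1.le) (Nat.cast_nonneg k)
    have : (2:ℝ) ≤ k := by linarith
    exact_mod_cast this
  clear hk hkge
  obtain ⟨m, r, hkm, hr⟩ : ∃ m r : ℕ, k = m + (m + r) ∧ r ≤ 1 :=
    ⟨k/2, k % 2, by omega, by omega⟩
  have hm1 : 1 ≤ m := by omega
  have hm0 : (0:ℝ) < m := by exact_mod_cast hm1
  have hk3 : (k:ℝ) ≤ 3 * m := by
    have : k ≤ 3 * m := by omega
    exact_mod_cast this
  have hk0 : (0:ℝ) < k := by exact_mod_cast (by omega : 0 < k)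
  set τ : ℝ := √(32 * k * L) with hτ
  have hτ2 : τ^2 = 32 * k * L := Real.sq_sqrt (by positivity)
  have hτ0 : 0 < τ := Real.sqrt_pos.mpr (by positivity)
  clear_value τ
  subst hkm
  have hfin : Real.exp (-(τ^2 / (2 * 4^2 * ((m + (m + r) : ℕ) : ℝ)))) = δ := by
    rw [← hδL, hτ2]
    congr 2
    field_simp
    norm_num
  refine ⟨fun x y => if Zst (m := m) (r := r) (fun j => (x j, y j)) < τ then 1 else 0,
    fun x y => by beta_reduce; split_ifs <;> norm_num, fun p q hp hq => ?_⟩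
  have hP := isPMF_prod p q hp hq
  rw [acceptProb_eq]
  simp only [Prod.mk.eta]
  set P : Fin n × Fin n → ℝ := fun a => p a.1 * q a.2 with hPdef
  constructor
  · intro hpq
    have hE : Ex (m + (m + r)) P (Zst (n := n) (m := m) (r := r)) = 0 := by
      rw [Ex_Zst _ hP]
      refine Finset.sum_eq_zero fun i _ => Finset.sum_eq_zero fun t _ => ?_
      rw [hPdef, Ex_Dst p q hp hq hP, hpq, sub_self]
      norm_num
    have ht := mcdiarmid_tail P hP 4 (by norm_num) (m + (m + r)) (by omega) _ Zst_BD τ hτ0.le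
      (fun z => 1 - if Zst (m := m) (r := r) z < τ then 1 else 0)
      (fun z => by split_ifs <;> norm_num)
      (fun z hz => by rw [hE, sub_zero] at hz; simp [hz])
    rw [hfin, Ex_sub, Ex_const _ _ hP] at ht
    linarith
  · intro htv
    have hlow := Ex_Zst_lower (m := m) (r := r) p q hp hq hn
    have hnum := numeric m ((m + (m + r) : ℕ) : ℝ) n L ε (2 * m * tvDist p q) τ hm0 hn0 hL0 hε
      hk0 hk3 A3 B1 B2 (mul_le_mul_of_nonneg_left htv (by positivity)) hτ2
    have hE := hnum.trans hlow
    have hneg : Ex (m + (m + r)) P (fun z => - Zst (n := n) (m := m) (r := r) z) =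
        - Ex (m + (m + r)) P (Zst (n := n) (m := m) (r := r)) := by
      have := Ex_smul (m + (m + r)) P (-1) (Zst (n := n) (m := m) (r := r))
      simpa using this
    have hBD : BD (fun z => - Zst (n := n) (m := m) (r := r) z) 4 := by
      intro z j a
      have := Zst_BD (n := n) (m := m) (r := r) z j a
      rw [abs_sub_comm] at this
      simpa [sub_eq_add_neg, add_comm] using this
    have ht := mcdiarmid_tail P hP 4 (by norm_num) (m + (m + r)) (by omega) _ hBD τ hτ0.le
      (fun z => if Zst (m := m) (r := r) z < τ then 1 else 0)
      (fun z => by split_ifs <;> norm_num)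
      (fun z hz => by
        rw [hneg] at hz
        rw [if_neg]
        rw [not_lt]
        linarith)
    rw [hfin] at ht
    exact ht
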